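/- Let n ≥ 1 and let K_1, …, K_n be pairwise disjoint nonempty compact subsets of ℂ. Let h be holomorphic on ℂ ∖ (K_1 ∪ … ∪ K_n) with h(z) → 0 as z → ∞. Then there exist functions h_1, …, h_n, where each h_i is holomorphic on ℂ ∖ K_i and satisfies h_i(z) → 0 as z → ∞, such that h = h_1 + ⋯ + h_n on ℂ ∖ (K_1 ∪ … ∪ K_n); moreover the functions h_1, …, h_n are uniquely determined by these properties. -/

import Mathlib

open MeasureTheory Filter Set Metric

/-- twice the Wirtinger derivative -/
noncomputable def dbar (f : ℂ → ℂ) (z : ℂ) : ℂ :=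
  fderiv ℝ f z 1 + Complex.I * fderiv ℝ f z Complex.I

lemma fderiv_polar (L : ℂ →L[ℝ] ℂ) (θ : ℝ) :
    L (Complex.exp (θ * Complex.I)) + Complex.I * L (Complex.exp (θ * Complex.I) * Complex.I)
      = (Complex.exp (θ * Complex.I))⁻¹ * (L 1 + Complex.I * L Complex.I) := by
  have e1 : Complex.exp (θ * Complex.I) = (Real.cos θ) • (1:ℂ) + (Real.sin θ) • Complex.I := by
    rw [Complex.exp_mul_I]; simp
  have e2 : Complex.exp (θ * Complex.I) * Complex.I
      = (-Real.sin θ) • (1:ℂ) + (Real.cos θ) • Complex.I := by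
    rw [Complex.exp_mul_I]; simp
    linear_combination (Complex.sin θ) * Complex.I_mul_I
  have e3 : (Complex.exp (θ * Complex.I))⁻¹
      = Real.cos θ - Real.sin θ * Complex.I := by
    rw [← Complex.exp_neg, ← neg_mul, Complex.exp_mul_I]; simp; ring
  rw [e2, e3, e1, map_add, map_add, map_smul, map_smul, map_smul, map_smul]
  simp only [Complex.real_smul]
  push_cast
  linear_combination (L Complex.I * Complex.sin θ) * Complex.I_mul_I

lemma pompeiu (f : ℂ → ℂ) (hf : ContDiff ℝ 1 f) (hc : HasCompactSupport f) :
    ∫ w : ℂ, w⁻¹ * dbar f w = -(2 * Real.pi) * f 0 := by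
  set e : ℝ → ℂ := fun θ => Complex.exp (θ * Complex.I) with he
  have hec : Continuous e := by fun_prop
  set F1 : ℝ × ℝ → ℂ := fun p => fderiv ℝ f (p.1 * e p.2) (e p.2) with hF1
  set F2 : ℝ × ℝ → ℂ := fun p => fderiv ℝ f (p.1 * e p.2) (e p.2 * Complex.I) with hF2
  have hdc : Continuous (fderiv ℝ f) := hf.continuous_fderiv (by norm_num)
  have hF1c : Continuous F1 := by
    apply Continuous.clm_apply <;> fun_prop
  have hF2c : Continuous F2 := by
    apply Continuous.clm_apply <;> fun_prop
  have hnorm : ∀ r θ : ℝ, ‖(r:ℂ) * e θ‖ = |r| := by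
    intro r θ; simp [he, Complex.norm_exp_ofReal_mul_I]
  obtain ⟨R, hR⟩ := (hc.fderiv (𝕜 := ℝ)).isCompact.isBounded.subset_closedBall 0
  have hz : ∀ w : ℂ, R < ‖w‖ → fderiv ℝ f w = 0 := by
    intro w hw
    apply image_eq_zero_of_notMem_tsupport
    intro h
    have := hR h
    simp at this; linarith
  have hInt : ∀ F : ℝ × ℝ → ℂ, Continuous F → (∀ p : ℝ × ℝ, R < |p.1| → F p = 0) →
      IntegrableOn F (Ioi 0 ×ˢ Ioo (-Real.pi) Real.pi) := by
    intro F hF h0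
    refine IntegrableOn.of_forall_sdiff_eq_zero (s := Icc 0 R ×ˢ Icc (-Real.pi) Real.pi) ?_
      (measurableSet_Ioi.prod measurableSet_Ioo) ?_
    · exact hF.continuousOn.integrableOn_compact (isCompact_Icc.prod isCompact_Icc)
    · rintro ⟨r, θ⟩ ⟨⟨h1, h2⟩, h3⟩
      apply h0
      by_contra h4
      apply h3
      simp only [mem_Ioi, mem_Ioo] at h1 h2
      rw [abs_of_pos h1] at h4
      exact ⟨⟨h1.le, not_lt.1 h4⟩, h2.1.le, h2.2.le⟩
  have hi1 := hInt F1 hF1c (fun p hp => by simp only [hF1]; rw [hz _ (by rwa [hnorm])]; simp)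
  have hi2 := hInt F2 hF2c (fun p hp => by simp only [hF2]; rw [hz _ (by rwa [hnorm])]; simp)
  have I1 : ∫ p in Ioi 0 ×ˢ Ioo (-Real.pi) Real.pi, F1 p = -(2 * Real.pi) * f 0 := by
    rw [Measure.volume_eq_prod, ← setIntegral_prod_swap, setIntegral_prod]
    swap
    · have := hi1
      rw [IntegrableOn, Measure.volume_eq_prod, ← Measure.prod_restrict] at this
      rw [IntegrableOn, ← Measure.prod_restrict]
      exact this.swap
    have : ∀ θ : ℝ, ∫ r in Ioi (0:ℝ), F1 ((θ, r) : ℝ × ℝ).swap = - f 0 := by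
      intro θ
      have hd : ∀ r : ℝ, HasDerivAt (fun r : ℝ => f (r * e θ)) (F1 (r, θ)) r := by
        intro r
        have h1 : HasDerivAt (fun r : ℝ => (r:ℂ) * e θ) (e θ) r := by
          simpa using (Complex.ofRealCLM.hasDerivAt (x := r)).mul_const (e θ)
        exact ((hf.differentiable (by norm_num) _).hasFDerivAt).comp_hasDerivAt r h1
      have h2 : ContDiff ℝ 1 (fun r : ℝ => f (r * e θ)) :=
        hf.comp (Complex.ofRealCLM.contDiff.mul contDiff_const)
      have h3 : HasCompactSupport (fun r : ℝ => f (r * e θ)) := by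
        obtain ⟨S, hS⟩ := hc.isCompact.isBounded.subset_closedBall 0
        refine HasCompactSupport.intro (isCompact_closedBall (0:ℝ) S) ?_
        intro r hr
        apply image_eq_zero_of_notMem_tsupport
        intro h
        apply hr
        have := hS h
        rw [mem_closedBall_zero_iff, hnorm] at this
        simpa using this
      have h4 := h3.integral_Ioi_deriv_eq h2 0
      simp only [Complex.ofReal_zero, zero_mul] at h4
      rw [← h4]
      congr 1
      ext r
      rw [(hd r).deriv]; rfl
    simp only [this]
    rw [setIntegral_const]
    simp [Real.pi_pos.le]
    left; ring
  have I2 : ∫ p in Ioi 0 ×ˢ Ioo (-Real.pi) Real.pi, F2 p = 0 := by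
    rw [Measure.volume_eq_prod, setIntegral_prod _ hi2]
    apply setIntegral_eq_zero_of_forall_eq_zero
    intro r hr
    have hr0 : (0:ℝ) < r := hr
    have hd : ∀ θ : ℝ, HasDerivAt (fun θ : ℝ => f (r * e θ)) (r * F2 (r, θ)) θ := by
      intro θ
      have h1 : HasDerivAt (fun θ : ℝ => (r:ℂ) * e θ) (r • (e θ * Complex.I)) θ := by
        have := ((Complex.ofRealCLM.hasDerivAt (x := θ)).mul_const Complex.I).cexp.const_mul (r:ℂ)
        simpa [he] using this
      have := ((hf.differentiable (by norm_num) _).hasFDerivAt).comp_hasDerivAt θ h1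
      rw [map_smul] at this
      rw [Complex.real_smul] at this
      exact this
    have h5 : ∫ θ in (-Real.pi)..Real.pi, (r:ℂ) * F2 (r, θ) = 0 := by
      rw [intervalIntegral.integral_eq_sub_of_hasDerivAt (fun θ _ => hd θ)]
      · simp [he]
      · apply Continuous.intervalIntegrable
        fun_prop
    rw [intervalIntegral.integral_const_mul, intervalIntegral.integral_of_le (by linarith [Real.pi_pos])] at h5
    rw [← integral_Ioc_eq_integral_Ioo]
    rcases mul_eq_zero.1 h5 with h | h
    · simp at h; linarith
    · exact h
  rw [← Complex.integral_comp_polarCoord_symm]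
  rw [polarCoord_target]
  have : ∀ p ∈ Ioi (0:ℝ) ×ˢ Ioo (-Real.pi) Real.pi,
      p.1 • ((Complex.polarCoord.symm p)⁻¹ * dbar f (Complex.polarCoord.symm p))
        = F1 p + Complex.I * F2 p := by
    rintro ⟨r, θ⟩ ⟨h1, h2⟩
    have hp : Complex.polarCoord.symm (r, θ) = r * e θ := by
      rw [Complex.polarCoord_symm_apply]; simp [he, Complex.exp_mul_I]
    have hr0 : (r:ℂ) ≠ 0 := by
      have : (0:ℝ) < r := h1
      exact_mod_cast this.ne'
    simp only [hp, hF1, hF2, dbar, he]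
    rw [fderiv_polar, Complex.real_smul, mul_inv]
    field_simp
  rw [setIntegral_congr_fun (measurableSet_Ioi.prod measurableSet_Ioo) this,
    integral_add hi1 (hi2.const_mul _), integral_const_mul, I1, I2]
  simp

lemma locInt_inv : LocallyIntegrable (fun w : ℂ => w⁻¹) := by
  refine locallyIntegrable_of_norm_le_rpow (C := 1) (α := 1) (by simp) (by simp) ?_ ?_
  · filter_upwards with x
    simp [Real.rpow_neg_one]
  · exact measurable_inv.aestronglyMeasurable

open Convolution in
lemma solve_dbar (ψ : ℂ → ℂ) (hψ : ContDiff ℝ 1 ψ) (hc : HasCompactSupport ψ) :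
    ∃ u : ℂ → ℂ, Differentiable ℝ u ∧ (∀ z, dbar u z = ψ z) ∧
      Tendsto u (cocompact ℂ) (nhds 0) := by
  set k : ℂ → ℂ := fun w => (2 * Real.pi : ℂ)⁻¹ * w⁻¹ with hk
  have hkl : LocallyIntegrable k := locInt_inv.smul (2 * Real.pi : ℂ)⁻¹
  set L := ContinuousLinearMap.mul ℝ ℂ
  have hD := hc.hasFDerivAt_convolution_right L hkl hψ
  refine ⟨k ⋆[L] ψ, fun z => (hD z).differentiableAt, ?_, ?_⟩
  · intro z
    have hpi : (2 * Real.pi : ℂ) ≠ 0 := by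
      simp [Real.pi_ne_zero]
    have hInt := (hc.fderiv (𝕜 := ℝ)).convolutionExists_right (L.precompR ℂ) hkl
      (hψ.continuous_fderiv (by norm_num)) z
    have happ : ∀ v, fderiv ℝ (k ⋆[L] ψ) z v = ∫ t, k t * fderiv ℝ ψ (z - t) v := by
      intro v
      rw [(hD z).fderiv, convolution_def, ContinuousLinearMap.integral_apply hInt]
      rfl
    have hiv : ∀ v, Integrable (fun t => k t * fderiv ℝ ψ (z - t) v) := fun v =>
      (ContinuousLinearMap.apply ℝ ℂ v).integrable_comp hInt
    rw [dbar, happ, happ, ← integral_const_mul, ← integral_add (hiv _) ((hiv _).const_mul _)]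
    have hP := pompeiu (fun w => ψ (z - w)) (hψ.comp (contDiff_const.sub contDiff_id))
      (hc.comp_homeomorph (Homeomorph.subLeft z))
    have hfd : ∀ w, dbar (fun w => ψ (z - w)) w = - dbar ψ (z - w) := by
      intro w
      simp only [dbar]
      have hcomp : HasFDerivAt (fun w => ψ (z - w))
          ((fderiv ℝ ψ (z - w)).comp (-(ContinuousLinearMap.id ℝ ℂ))) w :=
        ((hψ.differentiable (by norm_num) (z - w)).hasFDerivAt).comp w
          ((hasFDerivAt_id w).const_sub z)
      rw [hcomp.fderiv]
      simp; ring
    simp only [hfd, sub_zero] at hP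
    have : ∀ t, k t * fderiv ℝ ψ (z - t) 1 + Complex.I * (k t * fderiv ℝ ψ (z - t) Complex.I)
        = -(2 * Real.pi : ℂ)⁻¹ * (t⁻¹ * -dbar ψ (z - t)) := by
      intro t; simp only [hk, dbar]; ring
    simp only [this]
    rw [integral_const_mul, hP]
    field_simp
  · obtain ⟨R, hR⟩ := hc.isCompact.isBounded.subset_closedBall 0
    have hψi : Integrable ψ := hψ.continuous.integrable_of_hasCompactSupport hc
    have hb : ∀ z : ℂ, R < ‖z‖ → ‖(k ⋆[L] ψ) z‖ ≤
        (2 * Real.pi)⁻¹ * (‖z‖ - R)⁻¹ * ∫ t, ‖ψ t‖ := by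
      intro z hz
      have : (k ⋆[L] ψ) z = ∫ t, k (z - t) * ψ t := by
        rw [convolution_eq_swap]; rfl
      rw [this, ← integral_const_mul]
      refine norm_integral_le_of_norm_le (hψi.norm.const_mul _) ?_
      filter_upwards with t
      by_cases ht : t ∈ tsupport ψ
      · have h1 : ‖t‖ ≤ R := by simpa using hR ht
        have h2 : ‖z‖ - R ≤ ‖z - t‖ := by linarith [norm_sub_norm_le z t]
        rw [norm_mul]
        gcongr
        simp only [hk, norm_mul, norm_inv]
        have : ‖(2:ℂ)‖ * ‖(Real.pi:ℂ)‖ = 2 * Real.pi := by simp [abs_of_pos Real.pi_pos]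
        rw [this]
        have : 0 < ‖z‖ - R := by linarith
        gcongr
      · rw [image_eq_zero_of_notMem_tsupport ht]; simp
    have hn : Tendsto (fun z : ℂ => ‖z‖) (cocompact ℂ) atTop := tendsto_norm_cocompact_atTop
    have hlim : Tendsto (fun z : ℂ => (2 * Real.pi)⁻¹ * (‖z‖ - R)⁻¹ * ∫ t, ‖ψ t‖)
        (cocompact ℂ) (nhds 0) := by
      have h1 : Tendsto (fun z : ℂ => (‖z‖ - R)⁻¹) (cocompact ℂ) (nhds 0) :=
        tendsto_inv_atTop_zero.comp (tendsto_atTop_add_const_right _ (-R) hn)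
      simpa using (h1.const_mul (2 * Real.pi)⁻¹).mul_const (∫ t, ‖ψ t‖)
    refine squeeze_zero_norm' ?_ hlim
    filter_upwards [hn.eventually_gt_atTop R] with z hz using hb z hz

lemma piece (A B : Set ℂ) (hA : IsClosed A) (hB : IsClosed B) (h : ℂ → ℂ)
    (hh : DifferentiableOn ℂ h (A ∪ B)ᶜ) (χ u : ℂ → ℂ) (hχ : Differentiable ℝ χ)
    (hχB : ∀ z ∈ B, ∀ᶠ w in nhds z, χ w = 0) (hu : Differentiable ℝ u)
    (hdu : ∀ z, dbar u z = h z * dbar χ z) :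
    DifferentiableOn ℂ (fun z => χ z * h z - u z) Aᶜ := by
  intro z hz
  apply DifferentiableAt.differentiableWithinAt
  by_cases hzB : z ∈ B
  · have h0 := hχB z hzB
    have h1 : DifferentiableAt ℂ (fun z => - u z) z := by
      apply DifferentiableAt.fun_neg
      rw [differentiableAt_complex_iff_differentiableAt_real]
      refine ⟨hu z, ?_⟩
      have h2 := hdu z
      have h3 : dbar χ z = 0 := by
        have : χ =ᶠ[nhds z] fun _ => (0:ℂ) := h0
        simp [dbar, this.fderiv_eq]
      rw [h3, mul_zero, dbar] at h2
      rw [smul_eq_mul]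
      linear_combination (-Complex.I) * h2 + (fderiv ℝ u z Complex.I) * Complex.I_mul_I
    refine h1.congr_of_eventuallyEq ?_
    filter_upwards [h0] with w hw
    simp [hw]
  · have hzc : z ∈ (A ∪ B)ᶜ := by
      simp only [mem_compl_iff, mem_union, not_or]; exact ⟨hz, hzB⟩
    have hd : DifferentiableAt ℂ h z :=
      hh.differentiableAt ((hA.union hB).isOpen_compl.mem_nhds hzc)
    obtain ⟨hr, hcr⟩ := differentiableAt_complex_iff_differentiableAt_real.1 hd
    rw [differentiableAt_complex_iff_differentiableAt_real]
    have hm : DifferentiableAt ℝ (fun z => χ z * h z) z := (hχ z).fun_mul hr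
    refine ⟨hm.fun_sub (hu z), ?_⟩
    have h2 := hdu z
    rw [fderiv_fun_sub hm (hu z), fderiv_fun_mul (hχ z) hr]
    simp only [dbar] at h2
    simp only [_root_.sub_apply, _root_.add_apply,
      _root_.smul_apply, smul_eq_mul] at hcr ⊢
    rw [hcr]
    linear_combination (Complex.I) * h2 - (fderiv ℝ u z Complex.I - h z * fderiv ℝ χ z Complex.I) * Complex.I_mul_I

lemma two_sets (A B : Set ℂ) (hA : IsCompact A) (hB : IsCompact B) (hAB : Disjoint A B)
    (h : ℂ → ℂ) (hh : DifferentiableOn ℂ h (A ∪ B)ᶜ) (hh0 : Tendsto h (cocompact ℂ) (nhds 0)) :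
    ∃ H G : ℂ → ℂ, DifferentiableOn ℂ H Aᶜ ∧ DifferentiableOn ℂ G Bᶜ ∧
      Tendsto H (cocompact ℂ) (nhds 0) ∧ Tendsto G (cocompact ℂ) (nhds 0) ∧
      ∀ z, h z = H z + G z := by
  obtain ⟨T, hT, hAT, hTB⟩ := exists_compact_between hA hB.isClosed.isOpen_compl
    hAB.subset_compl_right
  obtain ⟨f, hf1, hf0, -⟩ := exists_contMDiffMap_one_nhds_of_subset_interior
    (n := 2) (modelWithCornersSelf ℝ ℂ) hA.isClosed hAT
  set χ : ℂ → ℂ := fun z => (f z : ℂ) with hχ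
  have hχs : ContDiff ℝ 2 χ := Complex.ofRealCLM.contDiff.comp f.contMDiff.contDiff
  have hχd : Differentiable ℝ χ := hχs.differentiable (by norm_num)
  have hχT : ∀ z ∈ Tᶜ, ∀ᶠ w in nhds z, χ w = 0 := by
    intro z hz
    filter_upwards [hT.isClosed.isOpen_compl.mem_nhds hz] with w hw
    simp [hχ, hf0 w hw]
  have hχA : ∀ z ∈ A, ∀ᶠ w in nhds z, χ w = 1 := by
    intro z hz
    filter_upwards [hf1.filter_mono (nhds_le_nhdsSet hz)] with w hw
    simp [hχ, hw]
  have hdz : ∀ z, ∀ c : ℂ, (∀ᶠ w in nhds z, χ w = c) → dbar χ z = 0 := by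
    intro z c hc
    have : χ =ᶠ[nhds z] fun _ => c := hc
    simp [dbar, this.fderiv_eq]
  have hdz' : ∀ z, ∀ c : ℂ, (∀ᶠ w in nhds z, χ w = c) → ∀ᶠ w in nhds z, dbar χ w = 0 := by
    intro z c hc
    filter_upwards [hc.eventually_nhds] with w hw using hdz w c hw
  have hopen : IsOpen (A ∪ B)ᶜ := (hA.isClosed.union hB.isClosed).isOpen_compl
  have hψ1 : ContDiff ℝ 1 (fun z => h z * dbar χ z) := by
    rw [contDiff_iff_contDiffAt]
    intro z
    have hzero : ∀ c : ℂ, (∀ᶠ w in nhds z, χ w = c) →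
        ContDiffAt ℝ 1 (fun z => h z * dbar χ z) z := by
      intro c hc
      refine (contDiffAt_const (c := (0:ℂ))).congr_of_eventuallyEq ?_
      filter_upwards [hdz' z c hc] with w hw
      simp [hw]
    by_cases hzA : z ∈ A
    · exact hzero 1 (hχA z hzA)
    by_cases hzB : z ∈ B
    · exact hzero 0 (hχT z (fun hz => hTB hz hzB))
    have hzc : z ∈ (A ∪ B)ᶜ := by
      simp only [mem_compl_iff, mem_union, not_or]; exact ⟨hzA, hzB⟩
    have h1 : ContDiffAt ℝ 1 h z :=
      ((hh.contDiffOn (n := 1) hopen).contDiffAt (hopen.mem_nhds hzc)).restrict_scalars ℝ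
    have h2 : ContDiff ℝ 1 (fderiv ℝ χ) := hχs.fderiv_right (by norm_num)
    have h3 : ContDiff ℝ 1 (dbar χ) :=
      (h2.clm_apply contDiff_const).add (contDiff_const.mul (h2.clm_apply contDiff_const))
    exact h1.mul h3.contDiffAt
  have hψc : HasCompactSupport (fun z => h z * dbar χ z) := by
    refine HasCompactSupport.intro hT ?_
    intro z hz
    rw [hdz z 0 (hχT z hz), mul_zero]
  obtain ⟨u, hud, hu, hu0⟩ := solve_dbar _ hψ1 hψc
  have hHd := piece A B hA.isClosed hB.isClosed h hh χ u hχd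
    (fun z hz => hχT z (fun h => hTB h hz)) hud hu
  have hGd := piece B A hB.isClosed hA.isClosed h (by rwa [union_comm]) (fun z => 1 - χ z)
    (fun z => - u z) (hχd.const_sub 1)
    (fun z hz => by filter_upwards [hχA z hz] with w hw; simp [hw]) hud.fun_neg
    (fun z => by
      have := hu z
      simp only [dbar] at this ⊢
      rw [fderiv_fun_neg, fderiv_const_sub]
      simp only [_root_.neg_apply]
      linear_combination -this)
  have hH0 : Tendsto (fun z => χ z * h z - u z) (cocompact ℂ) (nhds 0) := by
    have : Tendsto (fun z => - u z) (cocompact ℂ) (nhds 0) := by simpa using hu0.neg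
    refine this.congr' ?_
    filter_upwards [hT.compl_mem_cocompact] with z hz
    simp [(hχT z hz).self_of_nhds]
  refine ⟨_, _, hHd, hGd, hH0, ?_, fun z => by ring⟩
  have := hh0.sub hH0
  rw [sub_zero] at this
  refine this.congr (fun z => by ring)

lemma glue (A B : Set ℂ) (hA : IsCompact A) (hB : IsCompact B) (hAB : Disjoint A B)
    (f g : ℂ → ℂ) (hf : DifferentiableOn ℂ f Aᶜ) (hg : DifferentiableOn ℂ g Bᶜ)
    (hfg : ∀ z ∈ (A ∪ B)ᶜ, f z = g z) (hf0 : Tendsto f (cocompact ℂ) (nhds 0)) :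
    ∀ z ∈ Aᶜ, f z = 0 := by
  classical
  set E : ℂ → ℂ := fun z => if z ∈ A then g z else f z with hE
  have hEf : ∀ z ∈ Aᶜ, E z = f z := fun z hz => if_neg hz
  have hEg : ∀ z ∈ Bᶜ, E z = g z := by
    intro z hz
    by_cases hzA : z ∈ A
    · exact if_pos hzA
    · rw [hEf z hzA, hfg z]
      simp only [mem_compl_iff, mem_union, not_or]; exact ⟨hzA, hz⟩
  have hEd : Differentiable ℂ E := by
    intro z
    by_cases hzA : z ∈ A
    · have hzB : Bᶜ ∈ nhds z :=
        hB.isClosed.isOpen_compl.mem_nhds (hAB.subset_compl_right hzA)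
      refine (hg.differentiableAt hzB).congr_of_eventuallyEq ?_
      filter_upwards [hzB] with w hw using hEg w hw
    · have hzB : Aᶜ ∈ nhds z := hA.isClosed.isOpen_compl.mem_nhds hzA
      refine (hf.differentiableAt hzB).congr_of_eventuallyEq ?_
      filter_upwards [hzB] with w hw using hEf w hw
  intro z hz
  rw [← hEf z hz]
  apply hEd.apply_eq_of_tendsto_cocompact
  refine hf0.congr' ?_
  filter_upwards [hA.compl_mem_cocompact] with w hw using (hEf w hw).symm

lemma exist_part {ι : Type*} [DecidableEq ι] (K : ι → Set ℂ) (hKc : ∀ i, IsCompact (K i))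
    (hKdisj : ∀ i j, i ≠ j → Disjoint (K i) (K j)) (s : Finset ι) :
    ∀ h : ℂ → ℂ, DifferentiableOn ℂ h (⋃ i ∈ s, K i)ᶜ → Tendsto h (cocompact ℂ) (nhds 0) →
    ∃ H : ι → ℂ → ℂ, (∀ i, DifferentiableOn ℂ (H i) (K i)ᶜ) ∧
      (∀ i, Tendsto (H i) (cocompact ℂ) (nhds 0)) ∧
      ∀ z ∈ (⋃ i ∈ s, K i)ᶜ, h z = ∑ i ∈ s, H i z := by
  induction s using Finset.induction_on with
  | empty =>
    intro h hd h0
    refine ⟨fun _ _ => 0, fun i => differentiableOn_const _, fun i => tendsto_const_nhds, ?_⟩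
    intro z _
    have : Differentiable ℂ h := by simpa [differentiableOn_univ] using hd
    simpa using this.apply_eq_of_tendsto_cocompact z h0
  | insert a s ha ih =>
    intro h hd h0
    rw [Finset.set_biUnion_insert] at hd
    obtain ⟨H₁, G, hH₁, hG, hH₁0, hG0, hsum⟩ := two_sets (K a) (⋃ i ∈ s, K i) (hKc a)
      (s.isCompact_biUnion fun i _ => hKc i)
      (by
        rw [disjoint_iUnion₂_right]
        intro i hi
        exact hKdisj a i (fun h => ha (h ▸ hi))) h hd h0
    obtain ⟨H, h1, h2, h3⟩ := ih G hG hG0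
    refine ⟨Function.update H a H₁, ?_, ?_, ?_⟩
    · intro i
      by_cases hi : i = a
      · subst hi; simpa using hH₁
      · simpa [hi] using h1 i
    · intro i
      by_cases hi : i = a
      · subst hi; simpa using hH₁0
      · simpa [hi] using h2 i
    · intro z hz
      rw [Finset.sum_insert ha, hsum z, Function.update_self]
      congr 1
      rw [h3 z (fun hz' => hz (by rw [Finset.set_biUnion_insert]; exact Or.inr hz'))]
      refine Finset.sum_congr rfl fun i hi => ?_
      rw [Function.update_of_ne (fun hia : i = a => ha (hia ▸ hi))]

/-- Decomposition of a holomorphic function on the complement of finitely many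
pairwise disjoint compact sets, vanishing at infinity, into a sum of functions
holomorphic off each individual compact set and vanishing at infinity;
the summands are uniquely determined on the complements. -/
theorem stmt0 (n : ℕ) (hn : 1 ≤ n) (K : Fin n → Set ℂ)
    (hKc : ∀ i, IsCompact (K i)) (hKne : ∀ i, (K i).Nonempty)
    (hKdisj : ∀ i j, i ≠ j → Disjoint (K i) (K j))
    (h : ℂ → ℂ) (hh : DifferentiableOn ℂ h (⋃ i, K i)ᶜ)
    (hh0 : Filter.Tendsto h (Filter.cocompact ℂ) (nhds 0)) :
    ∃ H : Fin n → ℂ → ℂ,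
      ((∀ i, DifferentiableOn ℂ (H i) (K i)ᶜ) ∧
        (∀ i, Filter.Tendsto (H i) (Filter.cocompact ℂ) (nhds 0)) ∧
        (∀ z ∈ (⋃ i, K i)ᶜ, h z = ∑ i, H i z)) ∧
      (∀ U : Fin n → ℂ → ℂ,
        (∀ i, DifferentiableOn ℂ (U i) (K i)ᶜ) →
        (∀ i, Filter.Tendsto (U i) (Filter.cocompact ℂ) (nhds 0)) →
        (∀ z ∈ (⋃ i, K i)ᶜ, h z = ∑ i, U i z) →
        ∀ i, ∀ z ∈ (K i)ᶜ, U i z = H i z) := by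
  obtain ⟨H, h1, h2, h3⟩ := exist_part K hKc hKdisj Finset.univ h (by simpa using hh) hh0
  have h3' : ∀ z ∈ (⋃ i, K i)ᶜ, h z = ∑ i, H i z := fun z hz => h3 z (by simpa using hz)
  refine ⟨H, ⟨h1, h2, h3'⟩, ?_⟩
  intro U hU1 hU2 hU3 i z hz
  have hun : K i ∪ (⋃ j ∈ Finset.univ.erase i, K j) = ⋃ j, K j := by
    rw [← Finset.set_biUnion_insert, Finset.insert_erase (Finset.mem_univ i)]
    simp
  have key := glue (K i) (⋃ j ∈ Finset.univ.erase i, K j) (hKc i)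
    (Finset.isCompact_biUnion _ fun j _ => hKc j)
    (by
      rw [disjoint_iUnion₂_right]
      intro j hj
      exact hKdisj i j (Finset.ne_of_mem_erase hj).symm)
    (fun z => U i z - H i z) (fun z => ∑ j ∈ Finset.univ.erase i, (H j z - U j z))
    ((hU1 i).sub (h1 i))
    (by
      apply DifferentiableOn.fun_sum
      intro j hj
      have hsub : (⋃ j ∈ Finset.univ.erase i, K j)ᶜ ⊆ (K j)ᶜ :=
        compl_subset_compl.2 (subset_biUnion_of_mem (u := K) hj)
      exact ((h1 j).mono hsub).sub ((hU1 j).mono hsub))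
    (by
      intro w hw
      rw [hun] at hw
      have e1 := h3' w hw
      have e2 := hU3 w hw
      rw [← Finset.add_sum_erase _ _ (Finset.mem_univ i)] at e1 e2
      rw [Finset.sum_sub_distrib]
      linear_combination e1 - e2)
    (by simpa using (hU2 i).sub (h2 i)) z hz
  exact sub_eq_zero.1 key
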